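/- Let p be an irreducible and aperiodic stochastic matrix on a countable set S admitting a stationary distribution π. Suppose there exist a state b₀ ∈ S, a constant θ ∈ (0,1), and for each pair (i,j) ∈ S×S a constant C_{ij} > 0, such that p^{(n),{b₀}}_{ij} ≤ C_{ij}·θ^n for all i,j ∈ S and all n ≥ 1. Then the chain converges to the stationary distribution exponentially fast: there exist θ̂ ∈ (0,1) and constants Ĉ_{ij} > 0, depending only on i and j, such that |p^{(n)}_{ij} − π_j| ≤ Ĉ_{ij}·θ̂^n for all i,j ∈ S and all n ≥ 1. (Proposition 4.3.) -/

import Mathlib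

open scoped Classical

/-- Taboo probabilities: `tabooP p B n i j` is the probability of going from `i` to `j`
in `n` steps while all intermediate states avoid the taboo set `B`. -/
noncomputable def tabooP {S : Type*} (p : S → S → ℝ) (B : Set S) : ℕ → S → S → ℝ
  | 0 => fun i j => if i = j then 1 else 0
  | 1 => fun i j => p i j
  | n + 2 => fun i j => ∑' r : ↥Bᶜ, p i (r : S) * tabooP p B (n + 1) (r : S) j

/-- `n`-step transition probabilities. -/
noncomputable def nstep {S : Type*} (p : S → S → ℝ) : ℕ → S → S → ℝ :=
  tabooP p (∅ : Set S)

open Filter Topology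

namespace PowerSeries

/-- The coefficients of `φ` are absolutely summable against the weights `R ^ n`. -/
def AbsSummableAt {𝕜 : Type*} [NormedField 𝕜] (R : ℝ) (φ : PowerSeries 𝕜) : Prop :=
  Summable fun n => ‖coeff n φ‖ * R ^ n

/-- The value at `z` of the series `φ`. -/
noncomputable def valueAt {𝕜 : Type*} [NormedField 𝕜] (φ : PowerSeries 𝕜) (z : 𝕜) : 𝕜 :=
  ∑' n, coeff n φ * z ^ n

section NormedField

variable {𝕜 : Type*} [NormedField 𝕜] {R : ℝ} {φ ψ : PowerSeries 𝕜}

theorem AbsSummableAt.mono {R' : ℝ} (h : φ.AbsSummableAt R) (h0 : 0 ≤ R') (hR : R' ≤ R) :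
    φ.AbsSummableAt R' :=
  Summable.of_nonneg_of_le (fun n => by positivity) (fun n => by gcongr) h

theorem AbsSummableAt.summable_norm (h : φ.AbsSummableAt R) {z : 𝕜} (hz : ‖z‖ ≤ R) :
    Summable fun n => ‖coeff n φ * z ^ n‖ := by
  refine (h.mono (norm_nonneg z) hz).congr fun n => ?_
  rw [norm_mul, norm_pow]

theorem AbsSummableAt.sub (hφ : φ.AbsSummableAt R) (hψ : ψ.AbsSummableAt R) (h0 : 0 ≤ R) :
    (φ - ψ).AbsSummableAt R := by
  refine Summable.of_nonneg_of_le (fun n => by positivity) (fun n => ?_) (Summable.add hφ hψ)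
  rw [map_sub, ← add_mul]
  gcongr
  exact norm_sub_le _ _

theorem AbsSummableAt.add (hφ : φ.AbsSummableAt R) (hψ : ψ.AbsSummableAt R) (h0 : 0 ≤ R) :
    (φ + ψ).AbsSummableAt R := by
  refine Summable.of_nonneg_of_le (fun n => by positivity) (fun n => ?_) (Summable.add hφ hψ)
  rw [map_add, ← add_mul]
  gcongr
  exact norm_add_le _ _

theorem AbsSummableAt.mul (hφ : φ.AbsSummableAt R) (hψ : ψ.AbsSummableAt R) (h0 : 0 ≤ R) :
    (φ * ψ).AbsSummableAt R := by
  have key := summable_norm_sum_mul_antidiagonal_of_summable_norm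
    (f := fun n => ‖coeff n φ‖ * R ^ n) (g := fun n => ‖coeff n ψ‖ * R ^ n)
    (Summable.norm hφ) (Summable.norm hψ)
  refine Summable.of_nonneg_of_le (fun n => by positivity) (fun n => ?_) key
  refine le_trans ?_ (le_abs_self _)
  rw [coeff_mul]
  calc _ ≤ (∑ x ∈ Finset.HasAntidiagonal.antidiagonal n, ‖coeff x.1 φ‖ * ‖coeff x.2 ψ‖) * R ^ n := by
        gcongr
        exact (norm_sum_le _ _).trans (Finset.sum_le_sum fun x _ => (norm_mul_le _ _))
    _ = _ := by
        rw [Finset.sum_mul]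
        refine Finset.sum_congr rfl fun x hx => ?_
        rw [← Finset.HasAntidiagonal.mem_antidiagonal.1 hx, pow_add]
        ring

theorem absSummableAt_X : (X : PowerSeries 𝕜).AbsSummableAt R := by
  refine summable_of_ne_finset_zero (s := {1}) fun n hn => ?_
  rw [coeff_X, if_neg (by simpa using hn)]
  simp

theorem absSummableAt_one : (1 : PowerSeries 𝕜).AbsSummableAt R := by
  refine summable_of_ne_finset_zero (s := {0}) fun n hn => ?_
  rw [coeff_one, if_neg (by simpa using hn)]
  simp

theorem valueAt_one (z : 𝕜) : (1 : PowerSeries 𝕜).valueAt z = 1 := by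
  rw [valueAt, tsum_eq_single 0 fun n hn => by simp [coeff_one, hn]]
  simp

theorem valueAt_X (z : 𝕜) : (X : PowerSeries 𝕜).valueAt z = z := by
  rw [valueAt, tsum_eq_single 1 fun n hn => by simp [coeff_X, hn]]
  simp

variable [CompleteSpace 𝕜]

theorem AbsSummableAt.hasSum (h : φ.AbsSummableAt R) {z : 𝕜} (hz : ‖z‖ ≤ R) :
    HasSum (fun n => coeff n φ * z ^ n) (φ.valueAt z) :=
  (h.summable_norm hz).of_norm.hasSum

theorem valueAt_sub (hφ : φ.AbsSummableAt R) (hψ : ψ.AbsSummableAt R) {z : 𝕜} (hz : ‖z‖ ≤ R) :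
    (φ - ψ).valueAt z = φ.valueAt z - ψ.valueAt z := by
  rw [← ((hφ.hasSum hz).sub (hψ.hasSum hz)).tsum_eq, valueAt]
  simp only [map_sub, sub_mul]

theorem valueAt_add (hφ : φ.AbsSummableAt R) (hψ : ψ.AbsSummableAt R) {z : 𝕜} (hz : ‖z‖ ≤ R) :
    (φ + ψ).valueAt z = φ.valueAt z + ψ.valueAt z := by
  rw [← ((hφ.hasSum hz).add (hψ.hasSum hz)).tsum_eq, valueAt]
  simp only [map_add, add_mul]

theorem valueAt_mul (hφ : φ.AbsSummableAt R) (hψ : ψ.AbsSummableAt R) {z : 𝕜} (hz : ‖z‖ ≤ R) :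
    (φ * ψ).valueAt z = φ.valueAt z * ψ.valueAt z := by
  rw [valueAt, valueAt, valueAt, tsum_mul_tsum_eq_tsum_sum_antidiagonal_of_summable_norm
    (hφ.summable_norm hz) (hψ.summable_norm hz)]
  refine tsum_congr fun n => ?_
  rw [coeff_mul, Finset.sum_mul]
  refine Finset.sum_congr rfl fun x hx => ?_
  rw [← Finset.HasAntidiagonal.mem_antidiagonal.1 hx, pow_add]
  ring

end NormedField

/-- A complex power series that converges absolutely beyond the closed unit disc and has no zero
there is invertible among the series with that property. -/
theorem AbsSummableAt.exists_mul_eq_one {φ : PowerSeries ℂ} {R : ℝ} (hR : 1 < R)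
    (hφ : φ.AbsSummableAt R) (hne : ∀ z : ℂ, ‖z‖ ≤ 1 → φ.valueAt z ≠ 0) :
    ∃ r, 1 < r ∧ ∃ ψ : PowerSeries ℂ, ψ.AbsSummableAt r ∧ φ * ψ = 1 := by
  have hdiff : DifferentiableOn ℂ φ.valueAt (Metric.ball 0 R) := by
    refine Complex.differentiableOn_tsum_of_summable_norm hφ (fun n => by fun_prop)
      Metric.isOpen_ball fun n w hw => ?_
    have : ‖w‖ < R := by simpa using hw
    rw [norm_mul, norm_pow]
    gcongr
  obtain ⟨δ, hδ, hsub⟩ := (isCompact_closedBall (0 : ℂ) 1).exists_cthickening_subset_open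
    (hdiff.continuousOn.isOpen_inter_preimage Metric.isOpen_ball isOpen_compl_singleton (t := {0}ᶜ))
    (fun z hz => by
      have hz : ‖z‖ ≤ 1 := by simpa using hz
      exact ⟨by simpa using hz.trans_lt hR, hne z hz⟩)
  rw [cthickening_closedBall hδ.le zero_le_one] at hsub
  lift δ to NNReal using hδ.le
  have hδ' : 0 < δ := by exact_mod_cast hδ
  have hinv : DifferentiableOn ℂ (fun z => (φ.valueAt z)⁻¹)
      (Metric.closedBall 0 ((δ + 1 : NNReal) : ℝ)) := by
    rw [NNReal.coe_add, NNReal.coe_one]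
    exact (hdiff.mono fun z hz => (hsub hz).1).inv fun z hz => (hsub hz).2
  have hps := hinv.hasFPowerSeriesOnBall (by positivity)
  set q := cauchyPowerSeries (fun z => (φ.valueAt z)⁻¹) 0 ((δ + 1 : NNReal) : ℝ)
  have hlt : ((δ / 2 + 1 : NNReal) : ENNReal) < q.radius := by
    refine lt_of_lt_of_le ?_ hps.r_le
    rw [ENNReal.coe_lt_coe]
    gcongr
    exact half_lt_self hδ'
  have hsum := q.summable_norm_mul_pow hlt
  have hψ : (mk q.coeff).AbsSummableAt ((δ / 2 + 1 : NNReal) : ℝ) := by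
    refine hsum.congr fun n => ?_
    rw [FormalMultilinearSeries.norm_apply_eq_norm_coef, coeff_mk]
  have hr : (1 : ℝ) < ((δ / 2 + 1 : NNReal) : ℝ) := by
    push_cast
    linarith
  refine ⟨_, hr, mk q.coeff, hψ, ?_⟩
  have hφ1 := hφ.mono zero_le_one hR.le
  have hψ1 := hψ.mono zero_le_one hr.le
  have hzero : HasFPowerSeriesAt (0 : ℂ → ℂ)
      (FormalMultilinearSeries.ofScalars ℂ fun n => coeff n (φ * mk q.coeff - 1)) 0 := by
    rw [hasFPowerSeriesAt_iff]
    filter_upwards [Metric.ball_mem_nhds (0 : ℂ) one_pos] with z hz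
    have hz : ‖z‖ ≤ 1 := by simpa using (Metric.mem_ball.1 hz).le
    have hval : (mk q.coeff).valueAt z = (φ.valueAt z)⁻¹ := by
      have := hps.hasSum (y := z) (by
        rw [Metric.eball_coe]
        simpa using hz.trans_lt (by linarith : (1 : ℝ) < δ + 1))
      rw [zero_add] at this
      rw [← this.tsum_eq, valueAt]
      refine tsum_congr fun n => ?_
      rw [FormalMultilinearSeries.apply_eq_pow_smul_coeff, coeff_mk, smul_eq_mul, mul_comm]
    have := ((hφ1.mul hψ1 zero_le_one).sub absSummableAt_one zero_le_one).hasSum hz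
    rw [valueAt_sub (hφ1.mul hψ1 zero_le_one) absSummableAt_one hz, valueAt_mul hφ1 hψ1 hz,
      valueAt_one, hval, mul_inv_cancel₀ (hne z hz), sub_self] at this
    simpa only [FormalMultilinearSeries.coeff_ofScalars, smul_eq_mul, zero_add, mul_comm,
      Pi.zero_apply] using this
  ext n
  have hn := congrFun ((FormalMultilinearSeries.ofScalars_series_eq_zero ℂ).1 hzero.eq_zero) n
  simpa [sub_eq_zero] using hn

section Real

variable {R : ℝ} {φ : PowerSeries ℝ}

theorem absSummableAt_map_ofReal :
    (map Complex.ofRealHom φ).AbsSummableAt R ↔ φ.AbsSummableAt R := by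
  simp [AbsSummableAt]

theorem valueAt_map_ofReal (x : ℝ) :
    (map Complex.ofRealHom φ).valueAt (x : ℂ) = (φ.valueAt x : ℂ) := by
  simp [valueAt, Complex.ofReal_tsum]

/-- Real version of `AbsSummableAt.exists_mul_eq_one`; zeros are still taken in the complex
unit disc. -/
theorem AbsSummableAt.exists_real_mul_eq_one (hR : 1 < R) (hφ : φ.AbsSummableAt R)
    (hne : ∀ z : ℂ, ‖z‖ ≤ 1 → (map Complex.ofRealHom φ).valueAt z ≠ 0) :
    ∃ r, 1 < r ∧ ∃ ψ : PowerSeries ℝ, ψ.AbsSummableAt r ∧ φ * ψ = 1 := by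
  obtain ⟨r, hr, ψ, hψ, hmul⟩ :=
    AbsSummableAt.exists_mul_eq_one hR (absSummableAt_map_ofReal.2 hφ) hne
  have h0 : constantCoeff φ ≠ 0 := by
    intro h
    have := congrArg constantCoeff hmul
    rw [map_mul, ← coeff_zero_eq_constantCoeff_apply, coeff_map,
      coeff_zero_eq_constantCoeff_apply, h] at this
    simp at this
  have hφinv : φ * φ⁻¹ = 1 := PowerSeries.mul_inv_cancel φ h0
  have hmap : map Complex.ofRealHom φ * map Complex.ofRealHom φ⁻¹ = 1 := by
    rw [← map_mul, hφinv, map_one]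
  have hψ' : ψ = map Complex.ofRealHom φ⁻¹ := by
    calc ψ = ψ * (map Complex.ofRealHom φ * map Complex.ofRealHom φ⁻¹) := by rw [hmap, mul_one]
      _ = map Complex.ofRealHom φ * ψ * map Complex.ofRealHom φ⁻¹ := by ring
      _ = _ := by rw [hmul, one_mul]
  exact ⟨r, hr, φ⁻¹, absSummableAt_map_ofReal.1 (hψ' ▸ hψ), hφinv⟩

/-- Partial sums of the coefficients of `φ` approach `φ(1)` geometrically fast. -/
theorem AbsSummableAt.exists_abs_sum_sub_le (hR : 1 < R) (hφ : φ.AbsSummableAt R) :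
    ∃ K, 0 ≤ K ∧ ∀ n, |∑ k ∈ Finset.range (n + 1), coeff k φ - φ.valueAt 1| ≤ K * R⁻¹ ^ n := by
  have h0 : 0 < R := by linarith
  have hs : Summable fun n => |coeff n φ| := by
    simpa using hφ.summable_norm (z := (1 : ℝ)) (by simpa using hR.le)
  have hv : φ.valueAt 1 = ∑' n, coeff n φ := by simp [valueAt]
  refine ⟨∑' n, |coeff n φ| * R ^ n, tsum_nonneg fun n => by positivity, fun n => ?_⟩
  have hpow : 0 < R ^ n := pow_pos h0 n
  rw [hv, ← hs.of_abs.sum_add_tsum_nat_add (n + 1), sub_add_cancel_left, abs_neg, inv_pow,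
    ← div_eq_mul_inv, le_div_iff₀ hpow]
  have hs' : Summable fun k => |coeff (k + (n + 1)) φ| := 
    (summable_nat_add_iff (f := fun k => |coeff k φ|) (n + 1)).2 hs
  have hφ' : Summable fun n => |coeff n φ| * R ^ n := hφ
  have hle : ∀ k, |coeff (k + (n + 1)) φ| * R ^ n
      ≤ |coeff (k + (n + 1)) φ| * R ^ (k + (n + 1)) := fun k =>
    mul_le_mul_of_nonneg_left (pow_le_pow_right₀ hR.le (by omega)) (abs_nonneg _)
  calc |∑' k, coeff (k + (n + 1)) φ| * R ^ n
      ≤ (∑' k, |coeff (k + (n + 1)) φ|) * R ^ n := by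
        gcongr
        exact norm_tsum_le_tsum_norm (f := fun k => coeff (k + (n + 1)) φ) hs'
    _ = ∑' k, |coeff (k + (n + 1)) φ| * R ^ n := tsum_mul_right.symm
    _ ≤ ∑' n, |coeff n φ| * R ^ n :=
        Summable.tsum_le_tsum_of_inj (g := fun n => |coeff n φ| * R ^ n) (· + (n + 1))
          (add_left_injective _) (fun k _ => by positivity) hle (hs'.mul_right _) hφ'

theorem one_sub_X_mul_mk_sum (φ : PowerSeries ℝ) :
    (1 - X) * mk (fun n => ∑ k ∈ Finset.range (n + 1), coeff k φ) = φ := by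
  ext n
  rw [sub_mul, one_mul, map_sub]
  cases n with
  | zero => simp
  | succ n => rw [coeff_succ_X_mul, coeff_mk, coeff_mk, Finset.sum_range_succ, add_sub_cancel_left]

theorem sum_coeff_one_sub_X_mul (φ : PowerSeries ℝ) (n : ℕ) :
    ∑ k ∈ Finset.range (n + 1), coeff k ((1 - X) * φ) = coeff n φ := by
  have h : ∀ k, coeff (k + 1) ((1 - X) * φ) = coeff (k + 1) φ - coeff k φ := fun k => by
    rw [sub_mul, one_mul, map_sub, coeff_succ_X_mul]
  rw [Finset.sum_range_succ', Finset.sum_congr rfl fun k _ => h k, Finset.sum_range_sub fun k => coeff k φ]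
  simp [sub_mul]

/-- A renewal theorem with geometric rate: if the coefficients of `f` form an aperiodic probability
distribution on the positive integers with exponentially small tails, then `(1 - X) / (1 - f)`
converges absolutely beyond the unit disc. -/
theorem AbsSummableAt.exists_one_sub_mul_eq_one_sub_X {f : PowerSeries ℝ} (hR : 1 < R)
    (hf : f.AbsSummableAt R) (hf_nonneg : ∀ n, 0 ≤ coeff n f) (hf_zero : coeff 0 f = 0)
    (hf_one : f.valueAt 1 = 1) (haper : ∀ d : ℕ, (∀ n, coeff n f ≠ 0 → d ∣ n) → d = 1) :
    ∃ r, 1 < r ∧ ∃ ψ : PowerSeries ℝ, ψ.AbsSummableAt r ∧ (1 - f) * ψ = 1 - X := by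
  have h0 : 0 ≤ R := by linarith
  have h1R : ‖(1 : ℝ)‖ ≤ R := by simpa using hR.le
  have hf_sum : HasSum (fun n => coeff n f) 1 := by
    simpa [hf_one] using hf.hasSum h1R
  set g : PowerSeries ℝ := mk fun n => ∑ k ∈ Finset.range (n + 1), coeff k (1 - f) with hg_def
  have hg_mul : (1 - X) * g = 1 - f := one_sub_X_mul_mk_sum _
  have hg_coeff : ∀ n, coeff n g = 1 - ∑ k ∈ Finset.range (n + 1), coeff k f := fun n => by
    simp [hg_def, coeff_one]
  have hg_nonneg : ∀ n, 0 ≤ coeff n g := fun n => by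
    rw [hg_coeff, sub_nonneg]
    exact sum_le_hasSum _ (fun k _ => hf_nonneg k) hf_sum
  obtain ⟨K, -, hK⟩ := (absSummableAt_one.sub hf h0).exists_abs_sum_sub_le hR
  have hval : (1 - f).valueAt 1 = 0 := by
    rw [valueAt_sub absSummableAt_one hf h1R, valueAt_one, hf_one, sub_self]
  obtain ⟨r, hr, hrR⟩ := exists_between hR
  have hr0 : 0 < r := by linarith
  have hg : g.AbsSummableAt r := by
    have hgeo : Summable fun n => K * (r / R) ^ n :=
      (summable_geometric_of_lt_one (by positivity) ((div_lt_one (by linarith)).2 hrR)).mul_left K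
    refine Summable.of_nonneg_of_le (fun n => by positivity) (fun n => ?_) hgeo
    have := hK n
    rw [hval, sub_zero] at this
    calc ‖coeff n g‖ * r ^ n ≤ K * R⁻¹ ^ n * r ^ n := by
          gcongr
          simpa [hg_def] using this
      _ = K * (r / R) ^ n := by rw [div_eq_mul_inv, mul_pow]; ring
  suffices hne : ∀ z : ℂ, ‖z‖ ≤ 1 → (map Complex.ofRealHom g).valueAt z ≠ 0 by
    obtain ⟨s, hs, ψ, hψ, hmul⟩ := hg.exists_real_mul_eq_one hr hne
    exact ⟨s, hs, ψ, hψ, by rw [← hg_mul, mul_assoc, hmul, mul_one]⟩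
  intro z hz hzero
  have hz1 : z ≠ 1 := by
    rintro rfl
    rw [← Complex.ofReal_one, valueAt_map_ofReal, Complex.ofReal_eq_zero] at hzero
    have hsum : HasSum (fun n => coeff n g) 0 := by
      simpa [hzero] using hg.hasSum (z := (1 : ℝ)) (by simpa using hr.le)
    have := congrFun ((hasSum_zero_iff_of_nonneg hg_nonneg).1 hsum) 0
    simp [hg_coeff, hf_zero] at this
  have hfz : (map Complex.ofRealHom f).valueAt z = 1 := by
    have hf1 := absSummableAt_map_ofReal.2 (hf.mono zero_le_one hR.le)
    have hg1 := absSummableAt_map_ofReal.2 (hg.mono zero_le_one hr.le)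
    have := congrArg (fun φ => valueAt (map Complex.ofRealHom φ) z) hg_mul
    simp only [map_mul, map_sub, map_one, map_X] at this
    rw [valueAt_mul (absSummableAt_one.sub absSummableAt_X zero_le_one) hg1 hz, hzero, mul_zero,
      valueAt_sub absSummableAt_one hf1 hz, valueAt_one] at this
    exact (sub_eq_zero.1 this.symm).symm
  have hre : HasSum (fun n => coeff n f * (z ^ n).re) 1 := by
    have := Complex.hasSum_re
      ((absSummableAt_map_ofReal.2 hf).hasSum (hz.trans hR.le))
    simpa [hfz] using this
  have hdiff := hf_sum.sub hre
  rw [sub_self] at hdiff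
  have hre_le : ∀ n, (z ^ n).re ≤ 1 := fun n =>
    (Complex.re_le_norm _).trans (by rw [norm_pow]; exact pow_le_one₀ (norm_nonneg z) hz)
  have hterm := (hasSum_zero_iff_of_nonneg fun n => by
    have := mul_le_mul_of_nonneg_left (hre_le n) (hf_nonneg n)
    simpa using this).1 hdiff
  refine hz1 (orderOf_eq_one_iff.1 (haper (orderOf z) fun n hn => orderOf_dvd_of_pow_eq_one ?_))
  have hren : (z ^ n).re = 1 := by
    have := congrFun hterm n
    simp only [Pi.zero_apply] at this
    have : coeff n f * (1 - (z ^ n).re) = 0 := by linarith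
    linarith [(mul_eq_zero.1 this).resolve_left hn]
  have hnorm : ‖z ^ n‖ ≤ 1 := by
    rw [norm_pow]
    exact pow_le_one₀ (norm_nonneg z) hz
  have hsq := Complex.sq_norm (z ^ n)
  rw [Complex.normSq_apply, hren] at hsq
  refine Complex.ext hren ?_
  rw [Complex.one_im]
  nlinarith [norm_nonneg (z ^ n), sq_nonneg (z ^ n).im]

end Real

end PowerSeries

section MarkovChain

variable {S : Type*} {p : S → S → ℝ} {B : Set S} {b : S}

/-- The matrix `p` with the columns in `B` replaced by zero. -/
noncomputable def killed (p : S → S → ℝ) (B : Set S) (i r : S) : ℝ :=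
  if r ∈ B then 0 else p i r

/-- A matrix with nonnegative entries whose rows sum to one. -/
structure IsStochastic (p : S → S → ℝ) : Prop where
  nonneg : ∀ i j, 0 ≤ p i j
  row : ∀ i, HasSum (p i) 1

theorem tabooP_succ (n : ℕ) (i j : S) :
    tabooP p B (n + 2) i j = ∑' r, killed p B i r * tabooP p B (n + 1) r j := by
  refine (tsum_subtype Bᶜ fun r => p i r * tabooP p B (n + 1) r j).trans (tsum_congr fun r => ?_)
  by_cases hr : r ∈ B <;> simp [killed, hr]

theorem nstep_succ (n : ℕ) (i j : S) :
    nstep p (n + 2) i j = ∑' r, p i r * nstep p (n + 1) r j := by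
  rw [nstep, tabooP_succ]
  simp [killed]

namespace IsStochastic

theorem killed_nonneg (hp : IsStochastic p) (i r : S) : 0 ≤ killed p B i r := by
  rw [killed]
  split_ifs
  exacts [le_rfl, hp.nonneg i r]

theorem killed_le (hp : IsStochastic p) (i r : S) : killed p B i r ≤ p i r := by
  rw [killed]
  split_ifs
  exacts [hp.nonneg i r, le_rfl]

theorem summable_mul (hp : IsStochastic p) {f : S → ℝ} (hf : ∀ r, f r ∈ Set.Icc 0 1) (i : S) :
    Summable fun r => p i r * f r :=
  Summable.of_nonneg_of_le (fun r => mul_nonneg (hp.nonneg i r) (hf r).1)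
    (fun r => mul_le_of_le_one_right (hp.nonneg i r) (hf r).2) (hp.row i).summable

theorem summable_killed_mul (hp : IsStochastic p) {f : S → ℝ} (hf : ∀ r, f r ∈ Set.Icc 0 1)
    (i : S) : Summable fun r => killed p B i r * f r :=
  Summable.of_nonneg_of_le (fun r => mul_nonneg (hp.killed_nonneg i r) (hf r).1)
    (fun r => mul_le_mul_of_nonneg_right (hp.killed_le i r) (hf r).1) (hp.summable_mul hf i)

theorem tsum_killed_mul_mem_Icc (hp : IsStochastic p) {f : S → ℝ} (hf : ∀ r, f r ∈ Set.Icc 0 1)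
    (i : S) : ∑' r, killed p B i r * f r ∈ Set.Icc 0 1 := by
  refine ⟨tsum_nonneg fun r => mul_nonneg (hp.killed_nonneg i r) (hf r).1, ?_⟩
  rw [← (hp.row i).tsum_eq]
  exact (hp.summable_killed_mul hf i).tsum_le_tsum
    (fun r => (mul_le_of_le_one_right (hp.killed_nonneg i r) (hf r).2).trans (hp.killed_le i r))
    (hp.row i).summable

theorem le_one (hp : IsStochastic p) (i j : S) : p i j ≤ 1 :=
  le_hasSum (hp.row i) j fun r _ => hp.nonneg i r

theorem tabooP_mem_Icc (hp : IsStochastic p) (n : ℕ) (i j : S) :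
    tabooP p B (n + 1) i j ∈ Set.Icc 0 1 := by
  induction n generalizing i with
  | zero => exact ⟨hp.nonneg i j, hp.le_one i j⟩
  | succ n ih =>
    rw [tabooP_succ]
    exact hp.tsum_killed_mul_mem_Icc ih i

theorem nstep_mem_Icc (hp : IsStochastic p) (n : ℕ) (i j : S) :
    nstep p (n + 1) i j ∈ Set.Icc 0 1 :=
  hp.tabooP_mem_Icc n i j

theorem tsum_mul_eq_add_killed (hp : IsStochastic p) (b : S) {f : S → ℝ}
    (hf : ∀ r, f r ∈ Set.Icc 0 1) (i : S) :
    ∑' r, p i r * f r = p i b * f b + ∑' r, killed p {b} i r * f r := by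
  rw [(hp.summable_mul hf i).tsum_eq_add_tsum_ite b]
  congr 1
  refine tsum_congr fun r => ?_
  by_cases hr : r = b <;> simp [killed, hr]

/-- Decomposition according to the first visit to `b`. -/
theorem nstep_eq_tabooP_add_sum (hp : IsStochastic p) (b : S) (n : ℕ) (i j : S) :
    nstep p (n + 2) i j = tabooP p {b} (n + 2) i j + ∑ x ∈ Finset.HasAntidiagonal.antidiagonal n,
      tabooP p {b} (x.1 + 1) i b * nstep p (x.2 + 1) b j := by
  induction n generalizing i with
  | zero =>
    rw [nstep_succ, hp.tsum_mul_eq_add_killed b fun r => hp.nstep_mem_Icc 0 r j, tabooP_succ]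
    simp [nstep, tabooP, add_comm]
  | succ n ih =>
    have hmem : ∀ x : ℕ × ℕ, ∀ r : S,
        tabooP p {b} (x.1 + 1) r b * nstep p (x.2 + 1) b j ∈ Set.Icc 0 1 := fun x r =>
      ⟨mul_nonneg (hp.tabooP_mem_Icc _ _ _).1 (hp.nstep_mem_Icc _ _ _).1,
        mul_le_one₀ (hp.tabooP_mem_Icc _ _ _).2 (hp.nstep_mem_Icc _ _ _).1
          (hp.nstep_mem_Icc _ _ _).2⟩
    have hs : ∀ x : ℕ × ℕ, Summable fun r => killed p {b} i r *
        (tabooP p {b} (x.1 + 1) r b * nstep p (x.2 + 1) b j) := fun x =>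
      hp.summable_killed_mul (hmem x) i
    rw [nstep_succ, hp.tsum_mul_eq_add_killed b fun r => hp.nstep_mem_Icc (n + 1) r j,
      tabooP_succ (n + 1), Finset.Nat.sum_antidiagonal_succ]
    simp_rw [ih, mul_add, Finset.mul_sum]
    rw [(hp.summable_killed_mul (fun r => hp.tabooP_mem_Icc (n + 1) r j) i).tsum_add
      (summable_sum fun x _ => hs x), Summable.tsum_finsetSum fun x _ => hs x]
    simp_rw [← mul_assoc, tsum_mul_right, ← tabooP_succ]
    have hone : tabooP p {b} (0 + 1) i b = p i b := rfl
    rw [hone]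
    ring

/-- The probability of never visiting `b` at a positive time. -/
noncomputable def _root_.escape (p : S → S → ℝ) (b i : S) : ℝ :=
  1 - ∑' n, tabooP p {b} (n + 1) i b

theorem one_sub_sum_tabooP_succ (hp : IsStochastic p) (b : S) (n : ℕ) (i : S) :
    1 - ∑ k ∈ Finset.range (n + 1), tabooP p {b} (k + 1) i b =
      ∑' r, killed p {b} i r * (1 - ∑ k ∈ Finset.range n, tabooP p {b} (k + 1) r b) := by
  have hone : (1 : ℝ) = p i b + ∑' r, killed p {b} i r := by
    simpa [(hp.row i).tsum_eq] using
      hp.tsum_mul_eq_add_killed b (f := fun _ => 1) (fun _ => by simp) i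
  have hs : ∀ k, Summable fun r => killed p {b} i r * tabooP p {b} (k + 1) r b := fun k =>
    hp.summable_killed_mul (fun r => hp.tabooP_mem_Icc k r b) i
  have hs1 : Summable fun r => killed p {b} i r := by
    simpa using hp.summable_killed_mul (B := {b}) (f := fun _ => 1) (fun _ => by simp) i
  simp_rw [mul_sub, mul_one, Finset.mul_sum]
  rw [hs1.tsum_sub (summable_sum fun k _ => hs k), Summable.tsum_finsetSum fun k _ => hs k,
    Finset.sum_range_succ', hone]
  simp_rw [← tabooP_succ]
  simp only [tabooP]
  ring

theorem one_sub_sum_tabooP_mem_Icc (hp : IsStochastic p) (b : S) (n : ℕ) (i : S) :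
    1 - ∑ k ∈ Finset.range n, tabooP p {b} (k + 1) i b ∈ Set.Icc 0 1 := by
  induction n generalizing i with
  | zero => simp
  | succ n ih =>
    rw [hp.one_sub_sum_tabooP_succ]
    exact hp.tsum_killed_mul_mem_Icc ih i

theorem summable_tabooP (hp : IsStochastic p) (b i : S) :
    Summable fun n => tabooP p {b} (n + 1) i b :=
  summable_of_sum_range_le (fun n => (hp.tabooP_mem_Icc n i b).1) fun n =>
    sub_nonneg.1 (hp.one_sub_sum_tabooP_mem_Icc b n i).1

theorem tendsto_escape (hp : IsStochastic p) (b i : S) :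
    Tendsto (fun n => 1 - ∑ k ∈ Finset.range n, tabooP p {b} (k + 1) i b) atTop
      (𝓝 (escape p b i)) :=
  (hp.summable_tabooP b i).hasSum.tendsto_sum_nat.const_sub 1

theorem escape_mem_Icc (hp : IsStochastic p) (b i : S) : escape p b i ∈ Set.Icc 0 1 :=
  isClosed_Icc.mem_of_tendsto (hp.tendsto_escape b i)
    (Eventually.of_forall fun n => hp.one_sub_sum_tabooP_mem_Icc b n i)

theorem escape_eq_tsum (hp : IsStochastic p) (b i : S) :
    escape p b i = ∑' r, killed p {b} i r * escape p b r := by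
  refine tendsto_nhds_unique ((tendsto_add_atTop_iff_nat 1).2 (hp.tendsto_escape b i)) ?_
  simp_rw [hp.one_sub_sum_tabooP_succ]
  refine tendsto_tsum_of_dominated_convergence (hp.row i).summable
    (fun r => (hp.tendsto_escape b r).const_mul _) (Eventually.of_forall fun n r => ?_)
  have hmem := hp.one_sub_sum_tabooP_mem_Icc b n r
  rw [Real.norm_of_nonneg (mul_nonneg (hp.killed_nonneg i r) hmem.1)]
  exact (mul_le_of_le_one_right (hp.killed_nonneg i r) hmem.2).trans (hp.killed_le i r)

/-- A nonnegative bounded harmonic function vanishing at `i` vanishes at all states accessible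
from `i`. -/
theorem eq_zero_of_nstep_pos (hp : IsStochastic p) {f : S → ℝ} (hf : ∀ r, f r ∈ Set.Icc 0 1)
    (hharm : ∀ i, f i = ∑' r, p i r * f r) {n : ℕ} {i j : S} (hi : f i = 0)
    (hn : 0 < nstep p (n + 1) i j) : f j = 0 := by
  have step : ∀ {i r : S}, f i = 0 → p i r ≠ 0 → f r = 0 := fun {i r} hi hr => by
    have h0 : HasSum (fun r => p i r * f r) 0 := by
      rw [← hi, hharm i]
      exact (hp.summable_mul hf i).hasSum
    have := congrFun ((hasSum_zero_iff_of_nonneg fun r =>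
      mul_nonneg (hp.nonneg i r) (hf r).1).1 h0) r
    exact (mul_eq_zero.1 this).resolve_left hr
  induction n generalizing i with
  | zero => exact step hi hn.ne'
  | succ n ih =>
    rw [nstep_succ] at hn
    obtain ⟨r, hr⟩ : ∃ r, p i r * nstep p (n + 1) r j ≠ 0 := by
      by_contra! h
      simp [h] at hn
    exact ih (step hi (left_ne_zero_of_mul hr))
      ((hp.nstep_mem_Icc n r j).1.lt_of_ne' (right_ne_zero_of_mul hr))

end IsStochastic

/-- The row vector `π` is a probability distribution that is invariant under `p`. -/
structure IsStationaryDistribution (p : S → S → ℝ) (π : S → ℝ) : Prop where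
  nonneg : ∀ j, 0 ≤ π j
  sum : HasSum π 1
  stat : ∀ j, HasSum (fun i => π i * p i j) (π j)

namespace IsStationaryDistribution

variable {π : S → ℝ}

theorem summable_mul (hπ : IsStationaryDistribution p π) {f : S → ℝ} (hf : ∀ r, f r ∈ Set.Icc 0 1) :
    Summable fun i => π i * f i :=
  Summable.of_nonneg_of_le (fun r => mul_nonneg (hπ.nonneg r) (hf r).1)
    (fun r => mul_le_of_le_one_right (hπ.nonneg r) (hf r).2) hπ.sum.summable

theorem tsum_mul_tsum (hp : IsStochastic p) (hπ : IsStationaryDistribution p π) {f : S → ℝ}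
    (hf : ∀ r, f r ∈ Set.Icc 0 1) :
    ∑' i, π i * ∑' r, p i r * f r = ∑' r, π r * f r := by
  have hmem : ∀ i, ∑' r, p i r * f r ∈ Set.Icc 0 1 := fun i => by
    simpa [killed] using hp.tsum_killed_mul_mem_Icc (B := ∅) hf i
  have hnonneg : 0 ≤ fun x : S × S => π x.1 * (p x.1 x.2 * f x.2) := fun x =>
    mul_nonneg (hπ.nonneg _) (mul_nonneg (hp.nonneg _ _) (hf _).1)
  have hs : Summable (Function.uncurry fun i r => π i * (p i r * f r)) := by
    refine (summable_prod_of_nonneg hnonneg).2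
      ⟨fun i => (hp.summable_mul hf i).mul_left (π i), ?_⟩
    simp only [tsum_mul_left]
    exact hπ.summable_mul hmem
  simp_rw [← tsum_mul_left]
  rw [← hs.tsum_comm]
  refine tsum_congr fun r => ?_
  simp_rw [← mul_assoc]
  rw [tsum_mul_right, (hπ.stat r).tsum_eq]

theorem tsum_mul_nstep (hp : IsStochastic p) (hπ : IsStationaryDistribution p π) (n : ℕ) (j : S) :
    ∑' i, π i * nstep p (n + 1) i j = π j := by
  induction n with
  | zero => exact (hπ.stat j).tsum_eq
  | succ n ih =>
    simp_rw [nstep_succ]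
    rw [hπ.tsum_mul_tsum hp fun r => hp.nstep_mem_Icc n r j, ih]

theorem pos (hp : IsStochastic p) (hπ : IsStationaryDistribution p π)
    (hirr : ∀ i j, ∃ n, 1 ≤ n ∧ 0 < nstep p n i j) (j : S) : 0 < π j := by
  obtain ⟨i, hi⟩ : ∃ i, π i ≠ 0 := by
    by_contra! h
    have := hπ.sum.tsum_eq
    simp [h] at this
  obtain ⟨n, hn1, hn⟩ := hirr i j
  obtain ⟨n, rfl⟩ := Nat.exists_eq_add_of_le' hn1
  rw [← hπ.tsum_mul_nstep hp n j]
  exact (hπ.summable_mul fun r => hp.nstep_mem_Icc n r j).tsum_pos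
    (fun r => mul_nonneg (hπ.nonneg r) (hp.nstep_mem_Icc n r j).1) i
    (mul_pos ((hπ.nonneg i).lt_of_ne' hi) hn)

/-- An irreducible chain with a stationary distribution visits every state almost surely. -/
theorem escape_eq_zero (hp : IsStochastic p) (hπ : IsStationaryDistribution p π)
    (hirr : ∀ i j, ∃ n, 1 ≤ n ∧ 0 < nstep p n i j) (b i : S) : escape p b i = 0 := by
  have hmem := hp.escape_mem_Icc b
  have hkilled : ∀ i r, killed p {b} i r * escape p b r =
      p i r * (if r = b then 0 else escape p b r) := fun i r => by
    by_cases hr : r = b <;> simp [killed, hr]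
  have hmem' : ∀ r, (if r = b then 0 else escape p b r) ∈ Set.Icc (0 : ℝ) 1 := fun r => by
    split_ifs
    exacts [by simp, hmem r]
  have hb : escape p b b = 0 := by
    have h := hπ.tsum_mul_tsum hp hmem'
    simp_rw [← hkilled, ← hp.escape_eq_tsum b] at h
    rw [(hπ.summable_mul hmem).tsum_eq_add_tsum_ite b] at h
    simp only [mul_ite, mul_zero] at h
    exact (mul_eq_zero.1 (by linarith : π b * escape p b b = 0)).resolve_left
      (hπ.pos hp hirr b).ne'
  have hharm : ∀ i, escape p b i = ∑' r, p i r * escape p b r := fun i => by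
    rw [hp.tsum_mul_eq_add_killed b hmem, hb, mul_zero, zero_add, ← hp.escape_eq_tsum]
  obtain ⟨n, hn1, hn⟩ := hirr b i
  obtain ⟨n, rfl⟩ := Nat.exists_eq_add_of_le' hn1
  exact hp.eq_zero_of_nstep_pos hmem hharm hb hn

/-- If the transition probabilities into `j` converge to a limit not depending on the initial
state, then that limit is the stationary probability of `j`. -/
theorem eq_of_tendsto_nstep (hp : IsStochastic p) (hπ : IsStationaryDistribution p π) {j : S} {L : ℝ}
    (hL : ∀ i, Tendsto (fun n => nstep p (n + 1) i j) atTop (𝓝 L)) : L = π j := by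
  have hlim : Tendsto (fun n => ∑' i, π i * nstep p (n + 1) i j) atTop (𝓝 (∑' i, π i * L)) := by
    refine tendsto_tsum_of_dominated_convergence hπ.sum.summable
      (fun i => (hL i).const_mul _) (Eventually.of_forall fun n i => ?_)
    have hmem := hp.nstep_mem_Icc n i j
    rw [Real.norm_of_nonneg (mul_nonneg (hπ.nonneg i) hmem.1)]
    exact mul_le_of_le_one_right (hπ.nonneg i) hmem.2
  simp_rw [hπ.tsum_mul_nstep hp] at hlim
  rw [tsum_mul_right, hπ.sum.tsum_eq, one_mul] at hlim
  exact tendsto_nhds_unique hlim tendsto_const_nhds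

end IsStationaryDistribution

/-- The generating function of the taboo probabilities, shifted by one step. -/
noncomputable def tabooSeries (p : S → S → ℝ) (B : Set S) (i j : S) : PowerSeries ℝ :=
  PowerSeries.mk fun n => tabooP p B (n + 1) i j

open PowerSeries

theorem coeff_tabooSeries (n : ℕ) (i j : S) :
    coeff n (tabooSeries p B i j) = tabooP p B (n + 1) i j :=
  coeff_mk _ _

theorem tabooSeries_empty_eq (hp : IsStochastic p) (b i j : S) :
    tabooSeries p ∅ i j =
      tabooSeries p {b} i j + X * (tabooSeries p {b} i b * tabooSeries p ∅ b j) := by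
  ext n
  cases n with
  | zero => rw [map_add, coeff_zero_X_mul, add_zero, coeff_tabooSeries, coeff_tabooSeries]; rfl
  | succ n =>
    rw [map_add, coeff_succ_X_mul, coeff_mul]
    simp only [coeff_tabooSeries]
    exact hp.nstep_eq_tabooP_add_sum b n i j

theorem absSummableAt_tabooSeries (hp : IsStochastic p) {θ C R : ℝ} (hθ : 0 < θ) (hR0 : 0 ≤ R)
    (hR : R < θ⁻¹) {i j : S} (hdecay : ∀ n : ℕ, 1 ≤ n → tabooP p B n i j ≤ C * θ ^ n) :
    (tabooSeries p B i j).AbsSummableAt R := by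
  have hlt : θ * R < 1 := by rwa [mul_comm, ← lt_inv_mul_iff₀' hθ, mul_one]
  refine Summable.of_nonneg_of_le (fun n => by positivity) (fun n => ?_)
    ((summable_geometric_of_lt_one (by positivity) hlt).mul_left (C * θ))
  rw [coeff_tabooSeries, Real.norm_of_nonneg (hp.tabooP_mem_Icc n i j).1]
  calc _ ≤ C * θ ^ (n + 1) * R ^ n := by
        gcongr
        exact hdecay _ (by omega)
    _ = _ := by rw [mul_pow]; ring

/-- If every return time to `b` avoiding `b` in between is divisible by `d`, so is every return
time to `b`. -/
theorem dvd_of_forall_tabooP_dvd (hp : IsStochastic p) {d : ℕ}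
    (hd : ∀ n, tabooP p {b} (n + 1) b b ≠ 0 → d ∣ n + 1) (n : ℕ)
    (hn : nstep p (n + 1) b b ≠ 0) : d ∣ n + 1 := by
  induction n using Nat.strong_induction_on with
  | _ n ih =>
    cases n with
    | zero => exact hd 0 hn
    | succ n =>
      rw [hp.nstep_eq_tabooP_add_sum b] at hn
      by_cases h : tabooP p {b} (n + 2) b b = 0
      · rw [h, zero_add] at hn
        obtain ⟨x, hx, hne⟩ := Finset.exists_ne_zero_of_sum_ne_zero hn
        have hxn := Finset.HasAntidiagonal.mem_antidiagonal.1 hx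
        have := dvd_add (hd _ (left_ne_zero_of_mul hne))
          (ih x.2 (by omega) (right_ne_zero_of_mul hne))
        rwa [show x.1 + 1 + (x.2 + 1) = n + 1 + 1 by omega] at this
      · exact hd _ h

end MarkovChain

/-- Proposition 4.3: if the taboo probabilities with taboo set `{b₀}` decay exponentially,
then an irreducible aperiodic chain with stationary distribution `π` converges to `π`
exponentially fast. -/
theorem stmt_4 {S : Type*} [Countable S] (p : S → S → ℝ)
    (hp_nonneg : ∀ i j, 0 ≤ p i j)
    (hp_row : ∀ i, HasSum (fun j => p i j) 1)
    (hirr : ∀ i j, ∃ n, 1 ≤ n ∧ 0 < nstep p n i j)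
    (haper : ∀ i, ∀ d : ℕ, (∀ n, 1 ≤ n → 0 < nstep p n i i → d ∣ n) → d = 1)
    (π : S → ℝ) (hπ_nonneg : ∀ j, 0 ≤ π j) (hπ_sum : HasSum π 1)
    (hπ_stat : ∀ j, HasSum (fun i => π i * p i j) (π j))
    (b₀ : S) (θ : ℝ) (hθ0 : 0 < θ) (hθ1 : θ < 1)
    (C : S → S → ℝ) (hC : ∀ i j, 0 < C i j)
    (hdecay : ∀ i j : S, ∀ n : ℕ, 1 ≤ n →
      tabooP p ({b₀} : Set S) n i j ≤ C i j * θ ^ n) :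
    ∃ θhat : ℝ, 0 < θhat ∧ θhat < 1 ∧ ∃ Chat : S → S → ℝ, (∀ i j, 0 < Chat i j) ∧
      ∀ i j : S, ∀ n : ℕ, 1 ≤ n → |nstep p n i j - π j| ≤ Chat i j * θhat ^ n := by
  have hp : IsStochastic p := ⟨hp_nonneg, hp_row⟩
  have hπ : IsStationaryDistribution p π := ⟨hπ_nonneg, hπ_sum, hπ_stat⟩
  obtain ⟨R, hR, hRθ⟩ := exists_between ((one_lt_inv₀ hθ0).2 hθ1)
  have hR0 : 0 ≤ R := by linarith
  have hT : ∀ i j, (tabooSeries p {b₀} i j).AbsSummableAt R := fun i j =>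
    absSummableAt_tabooSeries hp hθ0 hR0 hRθ (hdecay i j)
  have hhit : ∀ i, (tabooSeries p {b₀} i b₀).valueAt 1 = 1 := fun i => by
    have := hπ.escape_eq_zero hp hirr b₀ i
    rw [escape, sub_eq_zero] at this
    simpa [PowerSeries.valueAt, coeff_tabooSeries] using this.symm
  have hF := PowerSeries.absSummableAt_X.mul (hT b₀ b₀) hR0
  have h1R : ‖(1 : ℝ)‖ ≤ R := by simpa using hR.le
  obtain ⟨r, hr, V, hV, hFV⟩ := hF.exists_one_sub_mul_eq_one_sub_X hR
    (fun n => by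
      cases n with
      | zero => simp
      | succ n =>
        rw [PowerSeries.coeff_succ_X_mul, coeff_tabooSeries]
        exact (hp.tabooP_mem_Icc n b₀ b₀).1)
    (by simp)
    (by rw [PowerSeries.valueAt_mul PowerSeries.absSummableAt_X (hT b₀ b₀) h1R, hhit,
      PowerSeries.valueAt_X, mul_one])
    (fun d hd => haper b₀ d fun n hn1 hn => by
      obtain ⟨n, rfl⟩ := Nat.exists_eq_add_of_le' hn1
      refine dvd_of_forall_tabooP_dvd hp (fun m hm => hd (m + 1) ?_) n hn.ne'
      rwa [PowerSeries.coeff_succ_X_mul, coeff_tabooSeries])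
  set ρ := min r R
  have hρ : 1 < ρ := lt_min hr hR
  have hρ0 : 0 ≤ ρ := by linarith
  have h1ρ : ‖(1 : ℝ)‖ ≤ ρ := by simpa using hρ.le
  have hVρ : V.AbsSummableAt ρ := hV.mono hρ0 (min_le_left _ _)
  have hTρ : ∀ i j, (tabooSeries p {b₀} i j).AbsSummableAt ρ := fun i j =>
    (hT i j).mono hρ0 (min_le_right _ _)
  have hX : (PowerSeries.X : PowerSeries ℝ).AbsSummableAt ρ := PowerSeries.absSummableAt_X
  have h1X : (1 - PowerSeries.X : PowerSeries ℝ).AbsSummableAt ρ :=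
    PowerSeries.absSummableAt_one.sub hX hρ0
  have hQ : ∀ i j, (1 - PowerSeries.X) * tabooSeries p ∅ i j =
      (1 - PowerSeries.X) * tabooSeries p {b₀} i j +
        PowerSeries.X * (tabooSeries p {b₀} i b₀ * (tabooSeries p {b₀} b₀ j * V)) := by
    intro i j
    have hb := tabooSeries_empty_eq hp b₀ b₀ j
    have hi := tabooSeries_empty_eq hp b₀ i j
    linear_combination (1 - PowerSeries.X) * hi +
      PowerSeries.X * tabooSeries p {b₀} i b₀ * V * hb -
      PowerSeries.X * tabooSeries p {b₀} i b₀ * tabooSeries p ∅ b₀ j * hFV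
  have hmain : ∀ i j, ((1 - PowerSeries.X) * tabooSeries p {b₀} i j).AbsSummableAt ρ ∧
      (PowerSeries.X *
        (tabooSeries p {b₀} i b₀ * (tabooSeries p {b₀} b₀ j * V))).AbsSummableAt ρ := fun i j =>
    ⟨h1X.mul (hTρ i j) hρ0,
      hX.mul ((hTρ i b₀).mul ((hTρ b₀ j).mul hVρ hρ0) hρ0) hρ0⟩
  have hQs : ∀ i j, ((1 - PowerSeries.X) * tabooSeries p ∅ i j).AbsSummableAt ρ := fun i j => by
    rw [hQ]
    exact (hmain i j).1.add (hmain i j).2 hρ0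
  have hval : ∀ i j, ((1 - PowerSeries.X) * tabooSeries p ∅ i j).valueAt 1 =
      (tabooSeries p {b₀} b₀ j * V).valueAt 1 := fun i j => by
    rw [hQ, PowerSeries.valueAt_add (hmain i j).1 (hmain i j).2 h1ρ,
      PowerSeries.valueAt_mul h1X (hTρ i j) h1ρ,
      PowerSeries.valueAt_sub PowerSeries.absSummableAt_one hX h1ρ, PowerSeries.valueAt_one,
      PowerSeries.valueAt_mul hX ((hTρ i b₀).mul ((hTρ b₀ j).mul hVρ hρ0) hρ0) h1ρ,
      PowerSeries.valueAt_mul (hTρ i b₀) ((hTρ b₀ j).mul hVρ hρ0) h1ρ, PowerSeries.valueAt_X,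
      hhit, sub_self, zero_mul, zero_add, one_mul, one_mul]
  choose K hK0 hK using fun i j => (hQs i j).exists_abs_sum_sub_le hρ
  simp only [PowerSeries.sum_coeff_one_sub_X_mul, hval, coeff_tabooSeries] at hK
  have hρinv : 0 < ρ⁻¹ := by positivity
  have hρinv1 : ρ⁻¹ < 1 := inv_lt_one_of_one_lt₀ hρ
  have hlim : ∀ j, (tabooSeries p {b₀} b₀ j * V).valueAt 1 = π j := fun j => by
    refine hπ.eq_of_tendsto_nstep hp fun i => ?_
    rw [tendsto_iff_norm_sub_tendsto_zero]
    refine squeeze_zero (fun n => norm_nonneg _) (hK i j) ?_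
    simpa using (tendsto_pow_atTop_nhds_zero_of_lt_one hρinv.le hρinv1).const_mul (K i j)
  refine ⟨ρ⁻¹, hρinv, hρinv1, fun i j => K i j * ρ + 1, fun i j => ?_, fun i j n hn => ?_⟩
  · have := mul_nonneg (hK0 i j) hρ0
    linarith
  · obtain ⟨n, rfl⟩ := Nat.exists_eq_add_of_le' hn
    have h : |nstep p (n + 1) i j - _| ≤ _ := hK i j n
    rw [hlim] at h
    have hpow : K i j * ρ * ρ⁻¹ ^ (n + 1) = K i j * ρ⁻¹ ^ n := by
      rw [pow_succ]
      field_simp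
    have : 0 < ρ⁻¹ ^ (n + 1) := by positivity
    linarith [add_mul (K i j * ρ) 1 (ρ⁻¹ ^ (n + 1))]
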